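/- Let k be a field of characteristic zero, A = k[X₀,X₁] the polynomial ring in two variables, τ a k-derivation of A, and set P = τ(X₀), Q = τ(X₁). Then the subset { ⁅τ, f·τ⁆ + ⁅X₁·τ, g·τ⁆ : f, g ∈ A } of Der_k(A) is equal to { s·τ : s ∈ (P,Q) }, where (P,Q) denotes the ideal of A generated by P and Q. -/

import Mathlib

set_option synthInstance.maxHeartbeats 1000000
set_option maxHeartbeats 2000000

/-- Over a field of characteristic zero, every partial derivative is surjective. -/
theorem MvPolynomial.pderiv_surjective {σ k : Type*} [Field k] [CharZero k] (i : σ) :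
    Function.Surjective (MvPolynomial.pderiv (R := k) i) := by
  intro a
  refine MvPolynomial.induction_on' a ?_ ?_
  · intro m c
    refine ⟨MvPolynomial.monomial (m + Finsupp.single i 1) (c / ((m i : k) + 1)), ?_⟩
    have hm : (m i : k) + 1 ≠ 0 := Nat.cast_add_one_ne_zero _
    simp [MvPolynomial.pderiv_monomial, hm]
  · rintro p q ⟨u, rfl⟩ ⟨v, rfl⟩
    exact ⟨u + v, map_add _ u v⟩

/-- A derivation of a polynomial ring in two variables, in terms of partial derivatives. -/
theorem MvPolynomial.derivation_apply_fin_two {k : Type*} [CommRing k]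
    (τ : Derivation k (MvPolynomial (Fin 2) k) (MvPolynomial (Fin 2) k))
    (h : MvPolynomial (Fin 2) k) :
    τ h = MvPolynomial.pderiv 0 h * τ (MvPolynomial.X 0) +
      MvPolynomial.pderiv 1 h * τ (MvPolynomial.X 1) := by
  have key : τ = τ (MvPolynomial.X 0) • MvPolynomial.pderiv 0 +
      τ (MvPolynomial.X 1) • MvPolynomial.pderiv 1 := by
    refine MvPolynomial.derivation_ext fun i => ?_
    fin_cases i <;> simp [MvPolynomial.pderiv_X]
  conv_lhs => rw [key]
  simp [mul_comm]

/-- The bracket of two multiples of one derivation. -/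
theorem Derivation.lie_smul_smul_self {k A : Type*} [CommRing k] [CommRing A] [Algebra k A]
    (τ : Derivation k A A) (a b : A) :
    ⁅a • τ, b • τ⁆ = (a * τ b - b * τ a) • τ := by
  ext x
  simp only [Derivation.commutator_apply, Derivation.smul_apply, smul_eq_mul, Derivation.leibniz]
  ring

/-- The two-variable analogue of Claim 1, from the plane-curve case of Theorem A. -/
theorem stmt_8 (k : Type*) [Field k] [CharZero k]
    (τ : Derivation k (MvPolynomial (Fin 2) k) (MvPolynomial (Fin 2) k))
    (P Q : MvPolynomial (Fin 2) k)
    (hP : P = τ (MvPolynomial.X 0)) (hQ : Q = τ (MvPolynomial.X 1)) :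
    {D : Derivation k (MvPolynomial (Fin 2) k) (MvPolynomial (Fin 2) k) |
      ∃ f g : MvPolynomial (Fin 2) k,
        D = ⁅τ, f • τ⁆ + ⁅(MvPolynomial.X 1 : MvPolynomial (Fin 2) k) • τ, g • τ⁆} =
    {D : Derivation k (MvPolynomial (Fin 2) k) (MvPolynomial (Fin 2) k) |
      ∃ s ∈ Ideal.span {P, Q}, D = s • τ} := by
  subst hP hQ
  have bracket : ∀ f g : MvPolynomial (Fin 2) k,
      ⁅τ, f • τ⁆ + ⁅(MvPolynomial.X 1 : MvPolynomial (Fin 2) k) • τ, g • τ⁆ =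
        (τ (f + MvPolynomial.X 1 * g) - 2 * g * τ (MvPolynomial.X 1)) • τ := by
    intro f g
    have h₁ := τ.lie_smul_smul_self 1 f
    rw [one_smul] at h₁
    rw [h₁, τ.lie_smul_smul_self, ← add_smul]
    congr 1
    simp only [map_add, Derivation.leibniz, Derivation.map_one_eq_zero, smul_eq_mul]
    ring
  ext D
  simp only [Set.mem_ofPred_eq, bracket, Ideal.mem_span_pair]
  constructor
  · rintro ⟨f, g, rfl⟩
    refine ⟨_, ⟨MvPolynomial.pderiv 0 (f + MvPolynomial.X 1 * g),
      MvPolynomial.pderiv 1 (f + MvPolynomial.X 1 * g) - 2 * g, ?_⟩, rfl⟩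
    rw [MvPolynomial.derivation_apply_fin_two τ (f + MvPolynomial.X 1 * g)]
    ring
  · rintro ⟨_, ⟨a, b, rfl⟩, rfl⟩
    obtain ⟨h, rfl⟩ := MvPolynomial.pderiv_surjective 0 a
    have half : (2 : MvPolynomial (Fin 2) k) * MvPolynomial.C (2⁻¹ : k) = 1 := by
      rw [← map_ofNat (MvPolynomial.C : k →+* MvPolynomial (Fin 2) k) 2, ← map_mul,
        mul_inv_cancel₀ two_ne_zero, map_one]
    let g := MvPolynomial.C (2⁻¹ : k) * (MvPolynomial.pderiv 1 h - b)
    refine ⟨h - MvPolynomial.X 1 * g, g, ?_⟩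
    have hg : 2 * g = MvPolynomial.pderiv 1 h - b := by
      rw [← mul_assoc, half, one_mul]
    rw [sub_add_cancel, hg, MvPolynomial.derivation_apply_fin_two τ h]
    congr 1
    ring
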